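/- Let H be a real Hilbert space, F : H → H Fréchet differentiable with Lipschitz-continuous derivative: ‖F'(x₁) − F'(x₂)‖ ≤ M₂‖x₁ − x₂‖ for all x₁, x₂ in the ball U(r̃, x₀) with r̃ = 1/(2 M₂ m₁), where m₁ = ‖[F'(x₀)]⁻¹‖ and F'(x₀) is boundedly invertible. Assume 4 M₂ m₁² ‖F(x₀)‖ ≤ 1. Then the continuous modified Newton scheme ẋ(t) = −[F'(x₀)]⁻¹ F(x(t)), x(0) = x₀, has a unique solution on [0,∞), x(t) stays in U(r̃, x₀), x(t) converges to a solution x̂ of F(x) = 0, and ‖x(t) − x̂‖ ≤ 2 m₁ ‖F(x₀)‖ e^{−t/2} and ‖F(x(t))‖ ≤ ‖F(x₀)‖ e^{−t/2} for all t ≥ 0. -/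

import Mathlib

open RealInnerProductSpace

open Set Filter Metric Topology
open scoped NNReal

/-- A closed ball of a Hilbert space is a nonexpansive retract of the whole space. -/
lemma exists_lipschitz_retraction_closedBall {H : Type*} [NormedAddCommGroup H]
    [InnerProductSpace ℝ H] [CompleteSpace H] (c : H) {r : ℝ} (hr : 0 ≤ r) :
    ∃ P : H → H, LipschitzWith 1 P ∧ (∀ u, P u ∈ closedBall c r) ∧
      ∀ u ∈ closedBall c r, P u = u := by
  have hconv := convex_closedBall c r
  choose P hPmem hPmin using exists_norm_eq_iInf_of_complete_convex
    ⟨c, mem_closedBall_self hr⟩ (isClosed_closedBall (x := c) (ε := r)).isComplete hconv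
  have hP : ∀ u, ∀ w ∈ closedBall c r, ⟪u - P u, w - P u⟫ ≤ 0 := fun u =>
    (norm_eq_iInf_iff_real_inner_le_zero hconv (hPmem u)).1 (hPmin u)
  refine ⟨P, LipschitzWith.of_dist_le_mul fun u v => ?_, hPmem, fun u hu => ?_⟩
  · rw [NNReal.coe_one, one_mul, dist_eq_norm, dist_eq_norm]
    have h₁ := hP u (P v) (hPmem v)
    have h₂ := hP v (P u) (hPmem u)
    have key : ‖P u - P v‖ ^ 2 ≤ ⟪u - v, P u - P v⟫ := by
      rw [← real_inner_self_eq_norm_sq]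
      have : ⟪u - v, P u - P v⟫ - ⟪P u - P v, P u - P v⟫
          = -⟪u - P u, P v - P u⟫ - ⟪v - P v, P u - P v⟫ := by
        simp only [inner_sub_left, inner_sub_right]
        ring
      linarith
    have hcs := real_inner_le_norm (u - v) (P u - P v)
    by_contra! hlt
    nlinarith [norm_nonneg (u - v), norm_nonneg (P u - P v)]
  · have h := hP u u hu
    rw [real_inner_self_nonpos, sub_eq_zero] at h
    exact h.symm

/-- A bounded Lipschitz vector field has global integral curves. -/
lemma exists_forall_hasDerivAt_of_lipschitzWith_of_bounded {E : Type*} [NormedAddCommGroup E]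
    [NormedSpace ℝ E] [CompleteSpace E] {v : E → E} {K L : ℝ≥0} (hv : LipschitzWith K v)
    (hL : ∀ x, ‖v x‖ ≤ L) (x₀ : E) :
    ∃ x : ℝ → E, x 0 = x₀ ∧ ∀ t, HasDerivAt x (v (x t)) t := by
  have hlocal : ∀ T : ℝ, ∃ x : ℝ → E, x 0 = x₀ ∧ ∀ t ∈ Ioo (-T) T, HasDerivAt x (v (x t)) t := by
    intro T
    rcases le_or_gt T 0 with hT | hT
    · exact ⟨fun _ => x₀, rfl, fun t ht => by linarith [ht.1, ht.2]⟩
    have hPL : IsPicardLindelof (fun _ => v) (tmin := -T) (tmax := T)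
        ⟨0, by constructor <;> linarith⟩ x₀ (L * T.toNNReal) 0 L K :=
      .of_time_independent (fun x _ => hL x) hv.lipschitzOnWith (by simp [hT.le])
    obtain ⟨x, hx₀, hx⟩ := hPL.exists_eq_forall_mem_Icc_hasDerivWithinAt₀
    exact ⟨x, hx₀, fun t ht =>
      (hx t (Ioo_subset_Icc_self ht)).hasDerivAt (Icc_mem_nhds ht.1 ht.2)⟩
  choose x hx₀ hx using hlocal
  have hagree : ∀ {S T : ℝ}, 0 < S → S ≤ T → EqOn (x S) (x T) (Ioo (-S) S) := fun {S T} hS hST =>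
    ODE_solution_unique_of_mem_Ioo (v := fun _ => v) (s := fun _ => univ) (K := K) (t₀ := 0)
      (fun _ _ => hv.lipschitzOnWith) ⟨by linarith, hS⟩ (fun t ht => ⟨hx S t ht, trivial⟩)
      (fun t ht => ⟨hx T t ⟨by linarith [ht.1], by linarith [ht.2]⟩, trivial⟩)
      ((hx₀ S).trans (hx₀ T).symm)
  refine ⟨fun t => x (|t| + 1) t, hx₀ _, fun t => ?_⟩
  have ht : t ∈ Ioo (-(|t| + 1)) (|t| + 1) := abs_lt.1 (lt_add_one _)
  refine (hx _ t ht).congr_of_eventuallyEq ?_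
  filter_upwards [Ioo_mem_nhds ht.1 ht.2] with u hu
  have hu' : u ∈ Ioo (-(|u| + 1)) (|u| + 1) := abs_lt.1 (lt_add_one _)
  rcases le_total (|u| + 1) (|t| + 1) with h | h
  · exact hagree (by positivity) h hu'
  · exact (hagree (by positivity) h hu).symm

section NewtonFlow

variable {H : Type*} [NormedAddCommGroup H] [InnerProductSpace ℝ H]
  {F : H → H} {F' : H → H →L[ℝ] H} {A : H ≃L[ℝ] H} {x₀ : H} {r : ℝ} {y : ℝ → H}

lemma norm_le_exp_of_newtonFlow (hF : ∀ x, HasFDerivAt F (F' x) x)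
    (hpert : ∀ x ∈ closedBall x₀ r, ∀ w, ‖F' x (A.symm w) - w‖ ≤ ‖w‖ / 2) {T : ℝ}
    (hy : ∀ t ∈ Icc 0 T, HasDerivAt y (-(A.symm (F (y t)))) t)
    (hball : ∀ t ∈ Icc 0 T, y t ∈ closedBall x₀ r) {t : ℝ} (ht : t ∈ Icc 0 T) :
    ‖F (y t)‖ ≤ ‖F (y 0)‖ * Real.exp (-(t / 2)) := by
  set f : ℝ → ℝ := fun s => Real.exp s * ‖F (y s)‖ ^ 2
  have hder : ∀ s ∈ Icc 0 T, HasDerivAt f (Real.exp s * ‖F (y s)‖ ^ 2 +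
      Real.exp s * (2 * ⟪F (y s), F' (y s) (-(A.symm (F (y s))))⟫)) s := fun s hs =>
    (Real.hasDerivAt_exp s).mul ((hF (y s)).comp_hasDerivAt s (hy s hs)).norm_sq
  have hanti : AntitoneOn f (Icc 0 T) := by
    refine antitoneOn_of_hasDerivWithinAt_nonpos (convex_Icc 0 T)
      (fun s hs => (hder s hs).continuousAt.continuousWithinAt)
      (fun s hs => (hder s (interior_subset hs)).hasDerivWithinAt) fun s hs => ?_
    have hp := hpert _ (hball s (interior_subset hs)) (F (y s))
    set w := F (y s)
    have hcs := neg_le_of_abs_le (abs_real_inner_le_norm w (F' (y s) (A.symm w) - w))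
    rw [inner_sub_right, real_inner_self_eq_norm_sq] at hcs
    rw [map_neg, inner_neg_right, ← mul_add]
    refine mul_nonpos_of_nonneg_of_nonpos (Real.exp_pos s).le ?_
    nlinarith [mul_le_mul_of_nonneg_left hp (norm_nonneg w)]
  have h := hanti ⟨le_rfl, ht.1.trans ht.2⟩ ht ht.1
  simp only [f, Real.exp_zero, one_mul] at h
  have hexp : Real.exp t = Real.exp (t / 2) ^ 2 := by rw [← Real.exp_nat_mul]; ring_nf
  rw [hexp, ← mul_pow] at h
  rw [Real.exp_neg, ← div_eq_mul_inv, le_div_iff₀ (Real.exp_pos _), mul_comm]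
  exact (sq_le_sq₀ (by positivity) (norm_nonneg _)).1 h

lemma norm_sub_le_of_newtonFlow (hF : ∀ x, HasFDerivAt F (F' x) x)
    (hpert : ∀ x ∈ closedBall x₀ r, ∀ w, ‖F' x (A.symm w) - w‖ ≤ ‖w‖ / 2) {T : ℝ}
    (hy : ∀ t ∈ Icc 0 T, HasDerivAt y (-(A.symm (F (y t)))) t)
    (hball : ∀ t ∈ Icc 0 T, y t ∈ closedBall x₀ r) {s t : ℝ} (hs : 0 ≤ s) (hst : s ≤ t)
    (ht : t ≤ T) :
    ‖y t - y s‖ ≤ 2 * ‖(A.symm : H →L[ℝ] H)‖ * ‖F (y 0)‖ *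
      (Real.exp (-(s / 2)) - Real.exp (-(t / 2))) := by
  set m := ‖(A.symm : H →L[ℝ] H)‖
  have hsub : ∀ u ∈ Icc s t, u ∈ Icc 0 T := fun u hu => ⟨hs.trans hu.1, hu.2.trans ht⟩
  have hB : ∀ u, HasDerivAt (fun u => 2 * m * ‖F (y 0)‖ *
      (Real.exp (-(s / 2)) - Real.exp (-(u / 2)))) (m * (‖F (y 0)‖ * Real.exp (-(u / 2)))) u := by
    intro u
    have h := ((((hasDerivAt_id u).div_const 2).neg.exp).const_sub
      (Real.exp (-(s / 2)))).const_mul (2 * m * ‖F (y 0)‖)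
    refine h.congr_deriv ?_
    simp only [id, Pi.neg_apply]
    ring
  refine image_norm_le_of_norm_deriv_right_le_deriv_boundary (f := fun u => y u - y s)
    (f' := fun u => -(A.symm (F (y u))))
    (fun u hu => ((hy u (hsub u hu)).sub_const _).continuousAt.continuousWithinAt)
    (fun u hu => ((hy u (hsub u (Ico_subset_Icc_self hu))).sub_const _).hasDerivWithinAt)
    (by simp) hB (fun u hu => ?_) ⟨hst, le_rfl⟩
  rw [norm_neg]
  exact ((A.symm : H →L[ℝ] H).le_opNorm _).trans (mul_le_mul_of_nonneg_left
    (norm_le_exp_of_newtonFlow hF hpert hy hball (hsub u (Ico_subset_Icc_self hu)))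
    (norm_nonneg _))

/-- A trajectory that follows the Newton flow as long as it is in the ball never leaves it. -/
lemma mem_closedBall_of_newtonFlow (hF : ∀ x, HasFDerivAt F (F' x) x)
    (hpert : ∀ x ∈ closedBall x₀ r, ∀ w, ‖F' x (A.symm w) - w‖ ≤ ‖w‖ / 2)
    (hr : 0 < r) (hsmall : 2 * ‖(A.symm : H →L[ℝ] H)‖ * ‖F x₀‖ ≤ r) (hy₀ : y 0 = x₀)
    (hcont : ContinuousOn y (Ici 0))
    (hy : ∀ t, 0 ≤ t → y t ∈ closedBall x₀ r → HasDerivAt y (-(A.symm (F (y t)))) t)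
    {t : ℝ} (ht : 0 ≤ t) : y t ∈ closedBall x₀ r := by
  by_contra hout
  set S : Set ℝ := Ici 0 ∩ (fun s => dist (y s) x₀) ⁻¹' Ici r
  have hSclosed : IsClosed S :=
    (continuous_id.dist continuous_const |>.comp_continuousOn hcont).preimage_isClosed_of_isClosed isClosed_Ici isClosed_Ici
  have hSne : S.Nonempty := ⟨t, ht, (not_le.1 (mt mem_closedBall.2 hout)).le⟩
  have hSbdd : BddBelow S := ⟨0, fun s hs => hs.1⟩
  set τ := sInf S
  have hτ : τ ∈ S := hSclosed.csInf_mem hSne hSbdd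
  have hτ₀ : 0 ≤ τ := hτ.1
  have hbefore : ∀ s ∈ Ico 0 τ, dist (y s) x₀ ≤ r := fun s hs => by
    by_contra! h
    exact (csInf_le hSbdd (show s ∈ S from ⟨hs.1, h.le⟩)).not_gt hs.2
  have hτpos : 0 < τ := by
    refine hτ₀.lt_of_ne fun h => ?_
    have := hτ.2
    rw [← h] at this
    simp only [mem_preimage, hy₀, dist_self, mem_Ici] at this
    linarith
  have hball : ∀ s ∈ Icc 0 τ, y s ∈ closedBall x₀ r := by
    rw [← closure_Ico hτpos.ne]
    intro s hs
    have hmaps : MapsTo y (Ico 0 τ) (closedBall x₀ r) := hbefore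
    have hc : ContinuousOn y (closure (Ico 0 τ)) := by
      rw [closure_Ico hτpos.ne]
      exact hcont.mono Icc_subset_Ici_self
    exact isClosed_closedBall.closure_subset (hmaps.closure_of_continuousOn hc hs)
  have h := norm_sub_le_of_newtonFlow hF hpert (fun s hs => hy s hs.1 (hball s hs)) hball
    le_rfl hτ₀ le_rfl
  have hge : r ≤ ‖y τ - y 0‖ := by
    rw [hy₀, ← dist_eq_norm]
    exact hτ.2
  rw [hy₀, zero_div, neg_zero, Real.exp_zero] at h
  rw [hy₀] at hge
  have hexp : Real.exp (-(τ / 2)) ≤ 1 := Real.exp_le_one_iff.2 (by linarith)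
  nlinarith [mul_le_mul_of_nonneg_right hsmall (sub_nonneg.2 hexp),
    mul_pos hr (Real.exp_pos (-(τ / 2)))]

end NewtonFlow

/-- Theorem 2.1: convergence of the continuous modified Newton scheme
ẋ(t) = −[F'(x₀)]⁻¹ F(x(t)), x(0) = x₀. -/
theorem stmt2
    {H : Type*} [NormedAddCommGroup H] [InnerProductSpace ℝ H] [CompleteSpace H]
    (F : H → H) (F' : H → H →L[ℝ] H)
    (hF : ∀ x, HasFDerivAt F (F' x) x)
    (x₀ : H) (A : H ≃L[ℝ] H) (hA : (A : H →L[ℝ] H) = F' x₀)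
    (M₂ m₁ rtilde : ℝ) (hM₂ : 0 < M₂)
    (hm₁ : m₁ = ‖(A.symm : H →L[ℝ] H)‖)
    (hrtilde : rtilde = 1 / (2 * M₂ * m₁))
    (hLip : ∀ x₁ ∈ Metric.closedBall x₀ rtilde, ∀ x₂ ∈ Metric.closedBall x₀ rtilde,
      ‖F' x₁ - F' x₂‖ ≤ M₂ * ‖x₁ - x₂‖)
    (hsmall : 4 * M₂ * m₁ ^ 2 * ‖F x₀‖ ≤ 1) :
    ∃ x : ℝ → H,
      x 0 = x₀ ∧
      (∀ t ∈ Set.Ici (0 : ℝ), HasDerivAt x (-(A.symm (F (x t)))) t) ∧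
      (∀ t ∈ Set.Ici (0 : ℝ), x t ∈ Metric.closedBall x₀ rtilde) ∧
      (∀ y : ℝ → H, y 0 = x₀ → (∀ t ∈ Set.Ici (0 : ℝ), HasDerivAt y (-(A.symm (F (y t)))) t) →
        ∀ t ∈ Set.Ici (0 : ℝ), y t = x t) ∧
      ∃ xhat : H,
        F xhat = 0 ∧
        Filter.Tendsto x Filter.atTop (nhds xhat) ∧
        (∀ t ∈ Set.Ici (0 : ℝ), ‖x t - xhat‖ ≤ 2 * m₁ * ‖F x₀‖ * Real.exp (-(t / 2))) ∧
        (∀ t ∈ Set.Ici (0 : ℝ), ‖F (x t)‖ ≤ ‖F x₀‖ * Real.exp (-(t / 2))) := by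
  have hm₁nonneg : 0 ≤ m₁ := hm₁ ▸ norm_nonneg _
  rcases hm₁nonneg.eq_or_lt with h₀ | hpos
  · have hsub : Subsingleton H := by
      have hzero : (A.symm : H →L[ℝ] H) = 0 := norm_eq_zero.1 (by rw [← hm₁, ← h₀])
      refine ⟨fun u v => A.symm.injective ?_⟩
      exact (DFunLike.congr_fun hzero u).trans (DFunLike.congr_fun hzero v).symm
    refine ⟨fun _ => x₀, rfl, fun t _ => ?_, fun t _ => ?_, fun y _ _ t _ => Subsingleton.elim _ _,
      x₀, Subsingleton.elim _ _, tendsto_const_nhds, fun t _ => ?_, fun t _ => ?_⟩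
    · exact (hasDerivAt_const t x₀).congr_deriv (Subsingleton.elim _ _)
    · simp [hrtilde, ← h₀]
    · simp [← h₀]
    · simp [Subsingleton.elim (F x₀) 0]
  have hr : 0 < rtilde := by rw [hrtilde]; positivity
  have hMr : M₂ * rtilde * m₁ = 1 / 2 := by rw [hrtilde]; field_simp
  have hsmall' : 2 * m₁ * ‖F x₀‖ ≤ rtilde := by
    rw [hrtilde, le_div_iff₀ (by positivity)]
    linarith
  have hx₀mem : x₀ ∈ closedBall x₀ rtilde := mem_closedBall_self hr.le
  have hF'near : ∀ x ∈ closedBall x₀ rtilde, ‖F' x - F' x₀‖ ≤ M₂ * rtilde := fun x hx =>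
    (hLip x hx x₀ hx₀mem).trans (mul_le_mul_of_nonneg_left (mem_closedBall_iff_norm.1 hx) hM₂.le)
  have hpert : ∀ x ∈ closedBall x₀ rtilde, ∀ w, ‖F' x (A.symm w) - w‖ ≤ ‖w‖ / 2 := by
    intro x hx w
    have hw : F' x₀ (A.symm w) = w := by rw [← hA]; exact A.apply_symm_apply w
    calc ‖F' x (A.symm w) - w‖ = ‖(F' x - F' x₀) (A.symm w)‖ := by
          rw [sub_apply, hw]
      _ ≤ M₂ * rtilde * (m₁ * ‖w‖) := by
          refine ((F' x - F' x₀).le_of_opNorm_le (hF'near x hx) _).trans ?_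
          gcongr
          rw [hm₁]
          exact (A.symm : H →L[ℝ] H).le_opNorm w
      _ = ‖w‖ / 2 := by rw [← mul_assoc, hMr]; ring
  set v : H → H := fun x => -(A.symm (F x))
  obtain ⟨K, hK⟩ : ∃ K : ℝ≥0, LipschitzOnWith K v (closedBall x₀ rtilde) := by
    have hFLip : LipschitzOnWith (‖F' x₀‖ + M₂ * rtilde).toNNReal F (closedBall x₀ rtilde) := by
      refine (convex_closedBall x₀ rtilde).lipschitzOnWith_of_nnnorm_hasFDerivWithin_le
        (fun x _ => (hF x).hasFDerivWithinAt) fun x hx => ?_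
      rw [← NNReal.coe_le_coe, coe_nnnorm]
      refine le_trans ?_ (Real.le_coe_toNNReal _)
      linarith [norm_le_norm_add_norm_sub' (F' x) (F' x₀), hF'near x hx]
    exact ⟨_, ((A.symm : H →L[ℝ] H).lipschitz.comp_lipschitzOnWith hFLip).neg⟩
  obtain ⟨P, hP, hPmem, hPid⟩ := exists_lipschitz_retraction_closedBall x₀ hr.le
  have hvP : LipschitzWith (K * 1) (v ∘ P) := by
    rw [← lipschitzOnWith_univ]
    exact hK.comp hP.lipschitzOnWith fun u _ => hPmem u
  have hbound : ∀ u, ‖(v ∘ P) u‖ ≤ (‖v x₀‖₊ + K * rtilde.toNNReal : ℝ≥0) := by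
    intro u
    have h := hK.norm_sub_le (hPmem u) hx₀mem
    have h' := mul_le_mul_of_nonneg_left (mem_closedBall_iff_norm.1 (hPmem u)) K.coe_nonneg
    push_cast
    rw [Real.coe_toNNReal _ hr.le]
    rw [Function.comp_apply]
    linarith [norm_le_norm_add_norm_sub' (v (P u)) (v x₀)]
  obtain ⟨x, hx₀, hx⟩ := exists_forall_hasDerivAt_of_lipschitzWith_of_bounded hvP hbound x₀
  rw [hm₁] at hsmall'
  have hxball : ∀ t, 0 ≤ t → x t ∈ closedBall x₀ rtilde := fun t ht =>
    mem_closedBall_of_newtonFlow hF hpert hr hsmall' hx₀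
      (fun s _ => (hx s).continuousAt.continuousWithinAt)
      (fun s _ hs => by simpa [v, hPid _ hs] using hx s) ht
  have hxder : ∀ t, 0 ≤ t → HasDerivAt x (v (x t)) t := fun t ht => by
    simpa [hPid _ (hxball t ht)] using hx t
  have hdist : ∀ s t, 0 ≤ s → s ≤ t → ‖x t - x s‖ ≤ 2 * m₁ * ‖F x₀‖ * Real.exp (-(s / 2)) := by
    intro s t hs hst
    have h := norm_sub_le_of_newtonFlow hF hpert (T := t) (fun u hu => hxder u hu.1)
      (fun u hu => hxball u hu.1) hs hst le_rfl
    rw [hx₀, ← hm₁] at h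
    refine h.trans (mul_le_mul_of_nonneg_left ?_ (by positivity))
    linarith [Real.exp_pos (-(t / 2))]
  have hdecay : ∀ t, 0 ≤ t → ‖F (x t)‖ ≤ ‖F x₀‖ * Real.exp (-(t / 2)) := fun t ht => by
    have h := norm_le_exp_of_newtonFlow hF hpert (T := t) (fun u hu => hxder u hu.1)
      (fun u hu => hxball u hu.1) ⟨ht, le_rfl⟩
    rwa [hx₀] at h
  have hexp (c : ℝ) : Tendsto (fun t : ℝ => c * Real.exp (-(t / 2))) atTop (𝓝 0) := by
    have h : Tendsto (fun t : ℝ => Real.exp (-(t / 2))) atTop (𝓝 0) :=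
      Real.tendsto_exp_neg_atTop_nhds_zero.comp (tendsto_id.atTop_div_const two_pos)
    simpa using h.const_mul c
  have hmax : Tendsto (fun t : ℝ => max t 0) atTop atTop :=
    tendsto_atTop_mono (fun t => le_max_left t 0) tendsto_id
  have hcauchy : CauchySeq fun t => x (max t 0) := by
    refine cauchySeq_of_le_tendsto_0' _ (fun s t hst => ?_) ((hexp (2 * m₁ * ‖F x₀‖)).comp hmax)
    rw [dist_comm, dist_eq_norm]
    exact hdist _ _ (le_max_right _ _) (max_le_max_right 0 hst)
  obtain ⟨xhat, hxhat⟩ := cauchySeq_tendsto_of_complete hcauchy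
  have hlim : Tendsto x atTop (𝓝 xhat) := by
    refine hxhat.congr' ?_
    filter_upwards [eventually_ge_atTop 0] with t ht
    rw [max_eq_left ht]
  refine ⟨x, hx₀, hxder, hxball, fun y hy₀ hy t ht => ?_, xhat, ?_, hlim, fun t ht => ?_, hdecay⟩
  · have hycont : ContinuousOn y (Ici 0) := fun s hs => (hy s hs).continuousAt.continuousWithinAt
    have hyball : ∀ s, 0 ≤ s → y s ∈ closedBall x₀ rtilde := fun s hs =>
      mem_closedBall_of_newtonFlow hF hpert hr hsmall' hy₀ hycont (fun u hu _ => hy u hu) hs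
    exact ODE_solution_unique_of_mem_Icc_right (v := fun _ => v) (s := fun _ => closedBall x₀ rtilde)
      (fun _ _ => hK) (hycont.mono Icc_subset_Ici_self)
      (fun s hs => (hy s hs.1).hasDerivWithinAt) (fun s hs => hyball s hs.1)
      (fun s _ => (hx s).continuousAt.continuousWithinAt)
      (fun s hs => (hxder s hs.1).hasDerivWithinAt) (fun s hs => hxball s hs.1)
      (hy₀.trans hx₀.symm) ⟨ht, le_rfl⟩
  · have hFlim : Tendsto (fun t => F (x t)) atTop (𝓝 0) := by
      refine squeeze_zero_norm' ?_ (hexp ‖F x₀‖)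
      filter_upwards [eventually_ge_atTop 0] with t ht using hdecay t ht
    exact tendsto_nhds_unique ((hF xhat).continuousAt.tendsto.comp hlim) hFlim
  · rw [norm_sub_rev]
    refine le_of_tendsto (hlim.sub_const (x t)).norm ?_
    filter_upwards [eventually_ge_atTop t] with u hu using hdist t u ht hu
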